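/- Bernstein-type inequality for fractional powers of |f|^{p/2}: let d ≥ 1, p ∈ [2,∞), α ∈ [0,1], and 0 < r₁ < r₂. Then there exist constants c > 0 and C > 0 (depending only on d, p, α, r₁, r₂) such that for every j ∈ ℤ and every real-valued Schwartz function f on ℝ^d whose Fourier transform 𝓕f is supported in the annulus {ξ ∈ ℝ^d : r₁ 2^j ≤ |ξ| ≤ r₂ 2^j}, one has c · 2^{2αj/p} ‖f‖_{L^p} ≤ ( ∫_{ℝ^d} (2π|ξ|)^{2α} |𝓕(|f|^{p/2})(ξ)|² dξ )^{1/p} ≤ C · 2^{2αj/p} ‖f‖_{L^p}. -/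

import Mathlib

open MeasureTheory
open scoped ENNReal FourierTransform

theorem hasDerivAt_abs_rpow_mul_self {q : ℝ} (hq : 1 ≤ q) (y : ℝ) :
    HasDerivAt (fun s : ℝ => |s| ^ (q - 1) * s) (q * |y| ^ (q - 1)) y := by
  rcases eq_or_ne y 0 with rfl | hy
  · rcases hq.eq_or_lt with rfl | hq'
    · simpa using hasDerivAt_id' (0 : ℝ)
    · have h0 : (0 : ℝ) < q - 1 := by linarith
      rw [hasDerivAt_iff_tendsto_slope, abs_zero, Real.zero_rpow h0.ne', mul_zero]
      have hc : Continuous fun s : ℝ => |s| ^ (q - 1) :=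
        continuous_abs.rpow_const fun _ => Or.inr h0.le
      have ht := (hc.tendsto 0).mono_left (nhdsWithin_le_nhds (s := {0}ᶜ))
      simp only [abs_zero, Real.zero_rpow h0.ne'] at ht
      refine ht.congr' ?_
      filter_upwards [self_mem_nhdsWithin] with s hs
      have hs' : s ≠ 0 := hs
      simp [slope_def_field, hs']
  · have h1 := ((hasDerivAt_abs hy).rpow_const (p := q - 1) (Or.inl (abs_ne_zero.2 hy))).mul
      (hasDerivAt_id y)
    refine h1.congr_deriv ?_
    have h2 : |y| ^ (q - 1) = |y| ^ (q - 1 - 1) * |y| := by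
      rw [← Real.rpow_add_one (abs_ne_zero.2 hy)]; ring_nf
    have h3 : (SignType.sign y : ℝ) * y = |y| := sign_mul_self y
    simp only [id, mul_one]
    linear_combination (q - 1) * |y| ^ (q - 1 - 1) * h3 - (q - 1) * h2

theorem abs_rpow_mul_abs_self {q : ℝ} (hq : 1 ≤ q) (a : ℝ) : |a| ^ (q - 1) * |a| = |a| ^ q := by
  rcases eq_or_ne a 0 with rfl | ha
  · simp [Real.zero_rpow (by linarith : q ≠ 0)]
  · rw [← Real.rpow_add_one (abs_ne_zero.2 ha)]; ring_nf

theorem abs_abs_rpow_mul_self {q : ℝ} (hq : 1 ≤ q) (a : ℝ) :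
    |(|a| ^ (q - 1) * a)| = |a| ^ q := by
  rw [abs_mul, abs_of_nonneg (by positivity), abs_rpow_mul_abs_self hq]

theorem abs_rpow_mul_abs_sub_le {q : ℝ} (hq : 1 ≤ q) (a b : ℝ) :
    |a| ^ (q - 1) * |b - a| ≤ 2 * |(|b| ^ (q - 1) * b) - |a| ^ (q - 1) * a| := by
  have hm : ∀ {x y : ℝ}, |x| ≤ |y| → |x| ^ (q - 1) ≤ |y| ^ (q - 1) := fun h =>
    Real.rpow_le_rpow (abs_nonneg _) h (by linarith)
  have ha : 0 ≤ |a| ^ (q - 1) := by positivity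
  have hb : 0 ≤ |b| ^ (q - 1) := by positivity
  have h1 : |a| ≤ |b| → |a| ^ (q - 1) ≤ |b| ^ (q - 1) := hm
  have h2 : |b| ≤ |a| → |b| ^ (q - 1) ≤ |a| ^ (q - 1) := hm
  generalize |a| ^ (q - 1) = A at *
  generalize |b| ^ (q - 1) = B at *
  rcases le_total |a| |b| with h | h
  · have h3 := h1 h
    clear h1 h2 hm
    rcases abs_cases a with ⟨e1, _⟩ | ⟨e1, _⟩ <;> rcases abs_cases b with ⟨e2, _⟩ | ⟨e2, _⟩ <;>
    rw [e1, e2] at h <;>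
    rcases abs_cases (b - a) with ⟨e3, _⟩ | ⟨e3, _⟩ <;>
    rcases abs_cases (B * b - A * a) with ⟨e4, _⟩ | ⟨e4, _⟩ <;>
    rw [e3, e4] <;> nlinarith
  · have h3 := h2 h
    clear h1 h2 hm
    rcases abs_cases a with ⟨e1, _⟩ | ⟨e1, _⟩ <;> rcases abs_cases b with ⟨e2, _⟩ | ⟨e2, _⟩ <;>
    rw [e1, e2] at h <;>
    rcases abs_cases (b - a) with ⟨e3, _⟩ | ⟨e3, _⟩ <;>
    rcases abs_cases (B * b - A * a) with ⟨e4, _⟩ | ⟨e4, _⟩ <;>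
    rw [e3, e4] <;> nlinarith

/-- If a `C¹` path vanishes at some time in `[0, 1]`, then the square of its initial value is
controlled by the deviation of its modulus along the path. -/
theorem sq_le_integral_of_exists_zero {U U' : ℝ → ℝ} (hU : ∀ t, HasDerivAt U (U' t) t)
    (hU' : Continuous U') {s : ℝ} (hs : s ∈ Set.Icc (0 : ℝ) 1) (hs0 : U s = 0) :
    U 0 ^ 2 ≤ 2 * ∫ t in (0 : ℝ)..1, |(|U t| - |U 0|)| * |U' t| := by
  have hUc : Continuous U := continuous_iff_continuousAt.2 fun t => (hU t).continuousAt
  set c := |U 0|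
  have hder : ∀ t, HasDerivAt (fun t => c * U t - (|U t| ^ ((2 : ℝ) - 1) * U t) / 2)
      ((c - |U t|) * U' t) t := by
    intro t
    have h := ((hU t).const_mul c).sub
      (((hasDerivAt_abs_rpow_mul_self one_le_two (U t)).comp t (hU t)).div_const 2)
    refine h.congr_deriv ?_
    norm_num
    ring
  have hftc := intervalIntegral.integral_eq_sub_of_hasDerivAt (a := 0) (b := s)
    (fun t _ => hder t) (by apply Continuous.intervalIntegrable; fun_prop)
  have hle : |∫ t in (0 : ℝ)..s, (c - |U t|) * U' t| ≤
      ∫ t in (0 : ℝ)..1, |(|U t| - c)| * |U' t| := by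
    refine (intervalIntegral.abs_integral_le_integral_abs hs.1).trans ?_
    simp_rw [abs_mul, abs_sub_comm c]
    refine intervalIntegral.integral_mono_interval le_rfl hs.1 hs.2 ?_ ?_
    · exact Filter.Eventually.of_forall fun t => by positivity
    · apply Continuous.intervalIntegrable; fun_prop
  rw [hftc, hs0] at hle
  norm_num at hle
  have h2 : |U 0| * U 0 / 2 - c * U 0 = -(c * U 0) / 2 := by ring
  rw [h2, abs_div, abs_neg, abs_mul, abs_abs, ← sq, sq_abs, abs_two] at hle
  linarith

theorem abs_mul_abs_sub_le_integral {U U' : ℝ → ℝ} (hU : ∀ t, HasDerivAt U (U' t) t)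
    (hU' : Continuous U') :
    |U 0| * |U 1 - U 0| ≤ |U 0| * |(|U 1| - |U 0|)| +
      4 * ∫ t in (0 : ℝ)..1, |(|U t| - |U 0|)| * |U' t| := by
  have hUc : Continuous U := continuous_iff_continuousAt.2 fun t => (hU t).continuousAt
  have hI : 0 ≤ ∫ t in (0 : ℝ)..1, |(|U t| - |U 0|)| * |U' t| :=
    intervalIntegral.integral_nonneg zero_le_one fun t _ => by positivity
  by_cases h : 0 ≤ U 0 * U 1
  · have : |U 1 - U 0| = |(|U 1| - |U 0|)| := by
      rw [← sq_eq_sq₀ (abs_nonneg _) (abs_nonneg _), sq_abs, sq_abs]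
      have : |U 1| * |U 0| = U 1 * U 0 := by rw [← abs_mul, abs_of_nonneg]; linarith
      nlinarith [sq_abs (U 0), sq_abs (U 1)]
    rw [this]
    linarith
  · have hz : (0 : ℝ) ∈ Set.uIcc (U 0) (U 1) := by
      rw [Set.mem_uIcc]
      push Not at h
      rcases mul_neg_iff.1 h with h | h
      · exact Or.inr ⟨h.2.le, h.1.le⟩
      · exact Or.inl ⟨h.1.le, h.2.le⟩
    obtain ⟨s, hs, hs0⟩ := intermediate_value_uIcc hUc.continuousOn hz
    rw [Set.uIcc_of_le zero_le_one] at hs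
    have h1 := sq_le_integral_of_exists_zero hU hU' hs hs0
    have h2 : |U 1 - U 0| ≤ |(|U 1| - |U 0|)| + 2 * |U 0| := by
      have := abs_sub (U 1) (U 0)
      have := le_abs_self (|U 1| - |U 0|)
      linarith
    nlinarith [abs_nonneg (U 0), sq_abs (U 0)]

section FourierAnalysis

variable {V : Type*} [NormedAddCommGroup V] [InnerProductSpace ℝ V] [FiniteDimensional ℝ V]
  [MeasurableSpace V] [BorelSpace V]

theorem MeasureTheory.Integrable.continuous_fourier {u : V → ℂ} (h1 : Integrable u) :
    Continuous (𝓕 u) :=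
  VectorFourier.fourierIntegral_continuous Real.continuous_fourierChar
    (innerSL ℝ).continuous₂ h1

/-- Plancherel's theorem for functions in `L¹ ∩ L²`. -/
theorem lintegral_enorm_fourier_sq {u : V → ℂ} (h1 : Integrable u) (h2 : MemLp u 2) :
    ∫⁻ ξ, ‖𝓕 u ξ‖ₑ ^ 2 = ∫⁻ x, ‖u x‖ₑ ^ 2 := by
  set U : Lp ℂ 2 (volume : Measure V) := h2.toLp u
  have hcont := h1.continuous_fourier
  have hae : (𝓕 U : Lp ℂ 2 (volume : Measure V)) =ᵐ[volume] 𝓕 u := by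
    apply ae_eq_of_integral_contDiff_smul_eq
    · exact (Lp.memLp _).locallyIntegrable (by norm_num)
    · exact hcont.locallyIntegrable
    · intro φ hφ hφc
      have hg₁ : HasCompactSupport (Complex.ofRealCLM ∘ φ) := hφc.comp_left rfl
      have hg₂ : ContDiff ℝ (⊤ : ℕ∞) (Complex.ofRealCLM ∘ φ) := by fun_prop
      set Φ : SchwartzMap V ℂ := hg₁.toSchwartzMap hg₂
      have e1 : ∫ x, φ x • (𝓕 U : Lp ℂ 2 (volume : Measure V)) x =
          ∫ x, (𝓕 Φ) x • U x := by
        have := congrArg (fun T => T Φ) (Lp.fourier_toTemperedDistribution_eq U)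
        rw [TemperedDistribution.fourier_apply, Lp.toTemperedDistribution_apply,
          Lp.toTemperedDistribution_apply] at this
        rw [this]
        simp [Φ]
      have e2 : ∫ x, (𝓕 Φ) x • U x = ∫ x, (𝓕 (Φ : V → ℂ)) x • u x := by
        apply integral_congr_ae
        filter_upwards [h2.coeFn_toLp] with x hx
        rw [SchwartzMap.fourier_coe, hx]
      have e3 : ∫ x, (𝓕 (Φ : V → ℂ)) x • u x = ∫ x, Φ x • 𝓕 u x := by
        have := VectorFourier.integral_fourierIntegral_smul_eq_flip (L := innerₗ V)
          (μ := volume) (ν := volume) Real.continuous_fourierChar continuous_inner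
          Φ.integrable h1
        rw [flip_innerₗ] at this
        exact this
      rw [e1, e2, e3]
      simp [Φ]
  have hnorm : eLpNorm (𝓕 U : Lp ℂ 2 (volume : Measure V)) 2 volume = eLpNorm U 2 volume := by
    have := Lp.norm_fourier_eq U
    rw [Lp.norm_def, Lp.norm_def] at this
    exact (ENNReal.toReal_eq_toReal_iff' (Lp.eLpNorm_ne_top _) (Lp.eLpNorm_ne_top _)).1 this
  rw [eLpNorm_congr_ae hae, eLpNorm_congr_ae h2.coeFn_toLp] at hnorm
  have hsq : ∀ w : V → ℂ, eLpNorm w 2 volume ^ 2 = ∫⁻ x, ‖w x‖ₑ ^ 2 := fun w => by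
    have := eLpNorm_nnreal_pow_eq_lintegral (f := w) (μ := (volume : Measure V))
      (p := 2) (by norm_num)
    simp only [NNReal.coe_ofNat, ENNReal.coe_ofNat] at this
    exact_mod_cast this
  rw [← hsq, ← hsq, hnorm]

theorem fourier_comp_add_right_sub {u : V → ℂ} (h1 : Integrable u) (h ξ : V) :
    𝓕 (fun x => u (x + h) - u x) ξ =
      (((Real.fourierChar (inner ℝ h ξ) : Circle) : ℂ) - 1) * 𝓕 u ξ := by
  have hs : 𝓕 (fun x => u (x + h)) ξ = ((Real.fourierChar (inner ℝ h ξ) : Circle) : ℂ) * 𝓕 u ξ :=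
    congrFun (VectorFourier.fourierIntegral_comp_add_right Real.fourierChar volume (innerₗ V)
      u h) ξ
  have h1' : Integrable fun x => u (x + h) := h1.comp_add_right h
  rw [sub_mul, one_mul, ← hs]
  simp only [Real.fourier_eq, smul_sub]
  exact integral_sub ((Real.fourierIntegral_convergent_iff ξ).2 h1')
    ((Real.fourierIntegral_convergent_iff ξ).2 h1)

theorem lintegral_enorm_comp_add_right_sub_sq {u : V → ℂ} (h1 : Integrable u) (h2 : MemLp u 2)
    (h : V) :
    ∫⁻ x, ‖u (x + h) - u x‖ₑ ^ 2 =
      ∫⁻ ξ, ‖((Real.fourierChar (inner ℝ h ξ) : Circle) : ℂ) - 1‖ₑ ^ 2 * ‖𝓕 u ξ‖ₑ ^ 2 := by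
  have h2' : MemLp (fun x => u (x + h)) 2 :=
    h2.comp_measurePreserving (measurePreserving_add_right volume h)
  refine (lintegral_enorm_fourier_sq ((h1.comp_add_right h).sub h1) (h2'.sub h2)).symm.trans ?_
  refine lintegral_congr fun ξ => ?_
  rw [← mul_pow, ← enorm_mul, ← fourier_comp_add_right_sub h1]
  rfl

/-- A Schwartz function whose Fourier transform is that of `f` times a dilated Schwartz
multiplier is the convolution of `f` with the rescaled kernel. -/
theorem SchwartzMap.eq_integral_mul_of_fourier_eq {F κ f : SchwartzMap V ℂ} {r : ℝ}
    (h : ∀ ξ, 𝓕 (F : V → ℂ) ξ = 𝓕 (κ : V → ℂ) (r • ξ) * 𝓕 (f : V → ℂ) ξ) (x : V) :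
    F x = ∫ k, κ k * f (x - r • k) := by
  have hinv : ∀ (G : SchwartzMap V ℂ) (y : V),
      G y = ∫ ξ, Real.fourierChar (inner ℝ ξ y) • 𝓕 (G : V → ℂ) ξ := by
    intro G y
    rw [← Real.fourierInv_eq]
    exact (congrFun (G.continuous.fourierInv_fourier_eq G.integrable (𝓕 G).integrable) y).symm
  have hint : Integrable fun ξ => Real.fourierChar (inner ℝ ξ x) • 𝓕 (f : V → ℂ) ξ := by
    have := (Real.fourierIntegral_convergent_iff (μ := volume) (-x)).2 (𝓕 f).integrable
    simpa [SchwartzMap.fourier_coe] using this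
  have hflip := VectorFourier.integral_fourierIntegral_smul_eq_flip (L := r • innerₗ V)
    (μ := volume) (ν := volume) Real.continuous_fourierChar
    (by simpa using continuous_inner.const_mul r) κ.integrable hint
  rw [hinv F]
  refine Eq.trans ?_ (hflip.trans ?_)
  · refine integral_congr_ae (Filter.Eventually.of_forall fun ξ => ?_)
    have : VectorFourier.fourierIntegral Real.fourierChar volume (r • innerₗ V) κ ξ =
        𝓕 (κ : V → ℂ) (r • ξ) := by
      rw [Real.fourier_eq, VectorFourier.fourierIntegral]
      simp [inner_smul_right]
    simp only [this, h, smul_eq_mul, Circle.smul_def]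
    ring
  · refine integral_congr_ae (Filter.Eventually.of_forall fun k => ?_)
    simp only [smul_eq_mul]
    rw [hinv f, VectorFourier.fourierIntegral]
    congr 1
    refine integral_congr_ae (Filter.Eventually.of_forall fun ξ => ?_)
    simp only [smul_smul, ← AddChar.map_add_eq_mul]
    congr 2
    simp [inner_sub_right, inner_smul_right, real_inner_comm k ξ]
    ring

end FourierAnalysis

/-- Jensen's inequality for `lintegral` with an unnormalized weight. -/
theorem lintegral_mul_rpow_le {X : Type*} [MeasurableSpace X] {μ : Measure X}
    {K Φ : X → ℝ≥0∞} (hK : AEMeasurable K μ) (hΦ : AEMeasurable Φ μ) {p : ℝ} (hp : 1 ≤ p) :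
    (∫⁻ k, K k * Φ k ∂μ) ^ p ≤ (∫⁻ k, K k ∂μ) ^ (p - 1) * ∫⁻ k, K k * Φ k ^ p ∂μ := by
  have hp0 : 0 < p := by linarith
  have hinv : 0 ≤ 1 - p⁻¹ := by
    have := inv_le_one_of_one_le₀ hp
    linarith
  have h1 : ∫⁻ k, K k * Φ k ∂μ ≤
      (∫⁻ k, K k ∂μ) ^ (1 - p⁻¹) * (∫⁻ k, K k * Φ k ^ p ∂μ) ^ p⁻¹ := by
    refine Eq.trans_le ?_ (ENNReal.lintegral_mul_norm_pow_le hK (hK.mul (hΦ.pow_const p))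
      hinv (by positivity) (by ring))
    refine lintegral_congr fun k => ?_
    simp only [Pi.mul_apply]
    rw [ENNReal.mul_rpow_of_nonneg _ _ (by positivity), ENNReal.rpow_rpow_inv hp0.ne',
      ← mul_assoc, ← ENNReal.rpow_add_of_nonneg _ _ hinv (by positivity), sub_add_cancel,
      ENNReal.rpow_one]
  refine (ENNReal.rpow_le_rpow h1 hp0.le).trans_eq ?_
  rw [ENNReal.mul_rpow_of_nonneg _ _ hp0.le, ← ENNReal.rpow_mul, ENNReal.rpow_inv_rpow hp0.ne',
    sub_mul, inv_mul_cancel₀ hp0.ne', one_mul]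

/-- Cauchy–Schwarz for `lintegral`. -/
theorem lintegral_mul_le_sqrt_mul_sqrt {X : Type*} [MeasurableSpace X] {μ : Measure X}
    {F G : X → ℝ≥0∞} (hF : AEMeasurable F μ) (hG : AEMeasurable G μ) :
    ∫⁻ x, F x * G x ∂μ ≤
      (∫⁻ x, F x ^ 2 ∂μ) ^ (1 / 2 : ℝ) * (∫⁻ x, G x ^ 2 ∂μ) ^ (1 / 2 : ℝ) := by
  have := ENNReal.lintegral_mul_le_Lp_mul_Lq μ Real.HolderConjugate.two_two hF hG
  simpa only [Pi.mul_apply, ENNReal.rpow_two] using this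

section Convolution

variable {V : Type*} [NormedAddCommGroup V] [InnerProductSpace ℝ V] [FiniteDimensional ℝ V]
  [MeasurableSpace V] [BorelSpace V]

/-- Young's inequality `L¹ * L^p ⊆ L^p` for a rescaled kernel. -/
theorem lintegral_lintegral_mul_rpow_le {K Φ : V → ℝ≥0∞} (hK : Measurable K)
    (hΦ : Measurable Φ) {p : ℝ} (hp : 1 ≤ p) (r : ℝ) :
    ∫⁻ x, (∫⁻ k, K k * Φ (x - r • k)) ^ p ≤ (∫⁻ k, K k) ^ p * ∫⁻ x, Φ x ^ p := by
  calc ∫⁻ x, (∫⁻ k, K k * Φ (x - r • k)) ^ p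
      ≤ ∫⁻ x, (∫⁻ k, K k) ^ (p - 1) * ∫⁻ k, K k * Φ (x - r • k) ^ p :=
        lintegral_mono fun x => lintegral_mul_rpow_le hK.aemeasurable
          (by fun_prop) hp
    _ = (∫⁻ k, K k) ^ (p - 1) * ∫⁻ x, ∫⁻ k, K k * Φ (x - r • k) ^ p :=
        lintegral_const_mul _ (Measurable.lintegral_prod_right' (f := fun z : V × V =>
          K z.2 * Φ (z.1 - r • z.2) ^ p) (by fun_prop))
    _ = (∫⁻ k, K k) ^ (p - 1) * ∫⁻ k, K k * ∫⁻ x, Φ x ^ p := by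
        rw [lintegral_lintegral_swap (by fun_prop)]
        congr 1
        refine lintegral_congr fun k => ?_
        rw [lintegral_const_mul _ (by fun_prop),
          lintegral_sub_right_eq_self (fun x => Φ x ^ p) (r • k)]
    _ = (∫⁻ k, K k) ^ p * ∫⁻ x, Φ x ^ p := by
        rw [lintegral_mul_const _ hK, ← mul_assoc]
        congr 1
        nth_rewrite 2 [← ENNReal.rpow_one (∫⁻ k, K k)]
        rw [← ENNReal.rpow_add_of_nonneg _ _ (by linarith) zero_le_one, sub_add_cancel]

/-- A Schwartz kernel with vanishing integral that acts as the identity on functions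
spectrally supported in the annulus `r₁ ≤ |ξ| ≤ r₂`. -/
theorem exists_schwartzMap_fourier_eq_one_on_annulus {r₁ r₂ : ℝ} (hr₁ : 0 < r₁) (hr₂ : r₁ < r₂) :
    ∃ ψ : SchwartzMap V ℂ, ∫ k, ψ k = 0 ∧
      ∀ ξ : V, r₁ ≤ ‖ξ‖ → ‖ξ‖ ≤ r₂ → 𝓕 (ψ : V → ℂ) ξ = 1 := by
  let χ₁ : ContDiffBump (0 : V) := ⟨r₁ / 2, r₁, by positivity, by linarith⟩
  let χ₂ : ContDiffBump (0 : V) := ⟨r₂, 2 * r₂, by linarith, by linarith⟩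
  have hc₁ : HasCompactSupport (Complex.ofRealCLM ∘ χ₁) := χ₁.hasCompactSupport.comp_left rfl
  have hc₂ : HasCompactSupport (Complex.ofRealCLM ∘ χ₂) := χ₂.hasCompactSupport.comp_left rfl
  have hs₁ : ContDiff ℝ (⊤ : ℕ∞) (Complex.ofRealCLM ∘ χ₁) :=
    Complex.ofRealCLM.contDiff.comp χ₁.contDiff
  have hs₂ : ContDiff ℝ (⊤ : ℕ∞) (Complex.ofRealCLM ∘ χ₂) :=
    Complex.ofRealCLM.contDiff.comp χ₂.contDiff
  let η : SchwartzMap V ℂ := hc₂.toSchwartzMap hs₂ - hc₁.toSchwartzMap hs₁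
  have hη : ∀ ξ, η ξ = (χ₂ ξ : ℂ) - χ₁ ξ := fun ξ => rfl
  have hF : ∀ ξ, 𝓕 ((𝓕⁻ η : SchwartzMap V ℂ) : V → ℂ) ξ = η ξ := fun ξ => by
    rw [← SchwartzMap.fourier_coe, FourierTransform.fourier_fourierInv_eq]
  refine ⟨𝓕⁻ η, ?_, fun ξ h1 h2 => ?_⟩
  · have h0 := hF 0
    rw [Real.fourier_eq, hη,
      χ₁.one_of_mem_closedBall (Metric.mem_closedBall_self (half_pos hr₁).le),
      χ₂.one_of_mem_closedBall (by simp [χ₂, (hr₁.trans hr₂).le])] at h0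
    simpa using h0
  · rw [hF, hη, χ₁.zero_of_le_dist (by simpa [χ₁] using h1),
      χ₂.one_of_mem_closedBall (by simpa [χ₂] using h2)]
    simp

/-- If `𝓕 ψ (l⁻¹ • ·) = 1` on the spectral support of `f`, then convolution with the rescaled `ψ`
reproduces `f`. -/
theorem SchwartzMap.reproducing_formula {f ψ : SchwartzMap V ℂ} {l : ℝ}
    (h : ∀ ξ, 𝓕 (f : V → ℂ) ξ ≠ 0 → 𝓕 (ψ : V → ℂ) (l⁻¹ • ξ) = 1) (x : V) :
    f x = ∫ k, ψ k * f (x - l⁻¹ • k) := by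
  refine SchwartzMap.eq_integral_mul_of_fourier_eq (fun ξ => ?_) x
  by_cases hξ : 𝓕 (f : V → ℂ) ξ = 0
  · simp [hξ]
  · simp [h ξ hξ]

theorem SchwartzMap.reproducing_formula_fderiv {f ψ : SchwartzMap V ℂ} {l : ℝ} (hl : 0 < l)
    (h : ∀ ξ, 𝓕 (f : V → ℂ) ξ ≠ 0 → 𝓕 (ψ : V → ℂ) (l⁻¹ • ξ) = 1) (v x : V) :
    fderiv ℝ f x v = ∫ k, (l * fderiv ℝ ψ k v) * f (x - l⁻¹ • k) := by
  have hd : ∀ (G : SchwartzMap V ℂ) ξ, 𝓕 ((LineDeriv.lineDerivOp v G : SchwartzMap V ℂ) : V → ℂ) ξ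
      = 2 * Real.pi * Complex.I * (inner ℝ ξ v) * 𝓕 (G : V → ℂ) ξ := fun G ξ => by
    have ht : (fun x : V => inner ℝ x v).HasTemperateGrowth := by fun_prop
    have := congrArg (fun T : SchwartzMap V ℂ => T ξ) (SchwartzMap.fourier_lineDerivOp_eq G v)
    rw [SchwartzMap.fourier_coe] at this
    rw [this]
    simp [SchwartzMap.smulLeftCLM_apply_apply ht, SchwartzMap.fourier_coe]
    ring
  have key := SchwartzMap.eq_integral_mul_of_fourier_eq
    (F := LineDeriv.lineDerivOp v f) (κ := (l : ℂ) • LineDeriv.lineDerivOp v ψ) (f := f)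
    (r := l⁻¹) (fun ξ => ?_) x
  · simpa [SchwartzMap.lineDerivOp_apply_eq_fderiv] using key
  · have hsm : 𝓕 (((l : ℂ) • LineDeriv.lineDerivOp v ψ : SchwartzMap V ℂ) : V → ℂ) (l⁻¹ • ξ)
        = l * 𝓕 ((LineDeriv.lineDerivOp v ψ : SchwartzMap V ℂ) : V → ℂ) (l⁻¹ • ξ) := by
      rw [← SchwartzMap.fourier_coe, FourierTransform.fourier_smul]
      rfl
    rw [hsm, hd, hd]
    by_cases hξ : 𝓕 (f : V → ℂ) ξ = 0
    · simp [hξ]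
    · rw [h ξ hξ, inner_smul_left]
      have : (l : ℂ) ≠ 0 := by exact_mod_cast hl.ne'
      push_cast
      field_simp
      simp
      rw [mul_assoc, mul_inv_cancel₀ this, mul_one]

/-- Bernstein's inequality for directional derivatives. -/
theorem SchwartzMap.lintegral_enorm_fderiv_rpow_le {f ψ : SchwartzMap V ℂ} {l : ℝ} (hl : 0 < l)
    (h : ∀ ξ, 𝓕 (f : V → ℂ) ξ ≠ 0 → 𝓕 (ψ : V → ℂ) (l⁻¹ • ξ) = 1) {p : ℝ} (hp : 1 ≤ p) (v : V) :
    ∫⁻ x, ‖fderiv ℝ f x v‖ₑ ^ p ≤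
      (ENNReal.ofReal l * ‖v‖ₑ * ∫⁻ k, ‖fderiv ℝ ψ k‖ₑ) ^ p * ∫⁻ x, ‖f x‖ₑ ^ p := by
  have hψc : Continuous fun k => fderiv ℝ ψ k := (SchwartzMap.fderivCLM ℝ V ℂ ψ).continuous
  have hfc := f.continuous
  have hB : ∫⁻ k, ENNReal.ofReal l * ‖v‖ₑ * ‖fderiv ℝ ψ k‖ₑ =
      ENNReal.ofReal l * ‖v‖ₑ * ∫⁻ k, ‖fderiv ℝ ψ k‖ₑ := lintegral_const_mul _ (by fun_prop)
  rw [← hB]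
  refine le_trans (lintegral_mono fun x => ?_) (lintegral_lintegral_mul_rpow_le
    (K := fun k => ENNReal.ofReal l * ‖v‖ₑ * ‖fderiv ℝ ψ k‖ₑ) (Φ := fun y => ‖f y‖ₑ)
    (by fun_prop) (by fun_prop) hp l⁻¹)
  rw [SchwartzMap.reproducing_formula_fderiv hl h]
  refine ENNReal.rpow_le_rpow ((enorm_integral_le_lintegral_enorm _).trans
    (lintegral_mono fun k => ?_)) (by linarith)
  have e : ‖(l : ℂ)‖ₑ = ENNReal.ofReal l := by
    rw [← ofReal_norm, Complex.norm_real, Real.norm_of_nonneg hl.le]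
  simp only [enorm_mul, e]
  rw [mul_assoc (ENNReal.ofReal l) ‖v‖ₑ, mul_comm ‖v‖ₑ]
  gcongr
  exact (fderiv ℝ ψ k).le_opENorm v

end Convolution

section AbsRpow

variable {V : Type*} [NormedAddCommGroup V] [NormedSpace ℝ V] {q : ℝ}

theorem SchwartzMap.continuous_abs_rpow (f : SchwartzMap V ℝ) (hq : 0 ≤ q) :
    Continuous fun x => |f x| ^ q :=
  f.continuous.abs.rpow_const fun _ => Or.inr hq

/-- The modulus of the derivative of `|f| ^ (q - 1) * f` in direction `v`. -/
noncomputable def SchwartzMap.absRpowDeriv (f : SchwartzMap V ℝ) (q : ℝ) (v x : V) : ℝ :=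
  q * |f x| ^ (q - 1) * |fderiv ℝ f x v|

theorem SchwartzMap.continuous_fderiv_apply (f : SchwartzMap V ℝ) (v : V) :
    Continuous fun x => fderiv ℝ f x v :=
  (SchwartzMap.fderivCLM ℝ V ℝ f).continuous.clm_apply continuous_const

theorem SchwartzMap.continuous_absRpowDeriv (f : SchwartzMap V ℝ) (hq : 1 ≤ q) (v : V) :
    Continuous (f.absRpowDeriv q v) :=
  (continuous_const.mul (f.continuous_abs_rpow (by linarith))).mul (f.continuous_fderiv_apply v).abs

theorem SchwartzMap.hasDerivAt_abs_rpow_mul_self_comp_line (f : SchwartzMap V ℝ) (hq : 1 ≤ q)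
    (x v : V) (t : ℝ) :
    HasDerivAt (fun t : ℝ => |f (x + t • v)| ^ (q - 1) * f (x + t • v))
      (q * |f (x + t • v)| ^ (q - 1) * fderiv ℝ f (x + t • v) v) t := by
  have h1 : HasDerivAt (fun t : ℝ => x + t • v) v t := by
    simpa using ((hasDerivAt_id t).smul_const v).const_add x
  have h2 := (f.differentiable (x := x + t • v)).hasFDerivAt.comp_hasDerivAt t h1
  exact (hasDerivAt_abs_rpow_mul_self hq (f (x + t • v))).comp t h2

theorem SchwartzMap.abs_abs_rpow_sub_le (f : SchwartzMap V ℝ) (hq : 1 ≤ q) (x v : V) :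
    |(|f (x + v)| ^ q - |f x| ^ q)| ≤ ∫ t in (0 : ℝ)..1, f.absRpowDeriv q v (x + t • v) := by
  have hc : Continuous fun t : ℝ =>
      q * |f (x + t • v)| ^ (q - 1) * fderiv ℝ f (x + t • v) v :=
    (continuous_const.mul ((f.continuous_abs_rpow (by linarith)).comp (by fun_prop))).mul
      ((f.continuous_fderiv_apply v).comp (by fun_prop))
  have hftc := intervalIntegral.integral_eq_sub_of_hasDerivAt (a := 0) (b := 1)
    (fun t _ => f.hasDerivAt_abs_rpow_mul_self_comp_line hq x v t) (hc.intervalIntegrable _ _)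
  have h := intervalIntegral.abs_integral_le_integral_abs (μ := volume) (a := 0) (b := 1)
    (f := fun t : ℝ => q * |f (x + t • v)| ^ (q - 1) * fderiv ℝ f (x + t • v) v) zero_le_one
  rw [hftc] at h
  simp only [one_smul, zero_smul, add_zero] at h
  rw [← abs_abs_rpow_mul_self hq (f (x + v)), ← abs_abs_rpow_mul_self hq (f x)]
  refine (abs_abs_sub_abs_le _ _).trans (h.trans_eq ?_)
  refine intervalIntegral.integral_congr fun t _ => ?_
  simp only [absRpowDeriv, abs_mul]
  rw [abs_of_nonneg (by linarith : 0 ≤ q),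
    abs_of_nonneg (by positivity : 0 ≤ |f (x + t • v)| ^ (q - 1))]

theorem SchwartzMap.absRpowDeriv_nonneg (f : SchwartzMap V ℝ) (hq : 1 ≤ q) (v x : V) :
    0 ≤ f.absRpowDeriv q v x := by
  have : 0 ≤ q := by linarith
  unfold absRpowDeriv
  positivity

/-- Differences of `f`, weighted by `|f| ^ (2 * q - 1)`, are controlled by differences
of `|f| ^ q`. -/
theorem SchwartzMap.abs_rpow_mul_abs_rpow_mul_abs_sub_le (f : SchwartzMap V ℝ) (hq : 1 ≤ q)
    (x v : V) :
    |f x| ^ q * (|f x| ^ (q - 1) * |f (x + v) - f x|) ≤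
      2 * (|f x| ^ q * |(|f (x + v)| ^ q - |f x| ^ q)|) +
        8 * ∫ t in (0 : ℝ)..1, |(|f (x + t • v)| ^ q - |f x| ^ q)| *
          f.absRpowDeriv q v (x + t • v) := by
  have hc : Continuous fun t : ℝ =>
      q * |f (x + t • v)| ^ (q - 1) * fderiv ℝ f (x + t • v) v :=
    (continuous_const.mul ((f.continuous_abs_rpow (by linarith)).comp (by fun_prop))).mul
      ((f.continuous_fderiv_apply v).comp (by fun_prop))
  have h := abs_mul_abs_sub_le_integral
    (fun t => f.hasDerivAt_abs_rpow_mul_self_comp_line hq x v t) hc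
  have hW : ∀ t : ℝ, |q * |f (x + t • v)| ^ (q - 1) * fderiv ℝ f (x + t • v) v| =
      f.absRpowDeriv q v (x + t • v) := fun t => by
    rw [absRpowDeriv, abs_mul, abs_of_nonneg]
    have : 0 ≤ q := by linarith
    positivity
  simp only [hW, one_smul, zero_smul, add_zero, abs_abs_rpow_mul_self hq] at h
  have h2 := abs_rpow_mul_abs_sub_le hq (f x) (f (x + v))
  have h3 : 0 ≤ |f x| ^ q := by positivity
  nlinarith [mul_le_mul_of_nonneg_left h2 h3]

end AbsRpow

theorem ofReal_intervalIntegral_eq_lintegral {F : ℝ → ℝ} (hF : Continuous F) (h0 : ∀ t, 0 ≤ F t) :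
    ENNReal.ofReal (∫ t in (0 : ℝ)..1, F t) = ∫⁻ t in Set.Ioc (0 : ℝ) 1, ‖F t‖ₑ := by
  rw [intervalIntegral.integral_of_le zero_le_one, ofReal_integral_eq_lintegral_ofReal
    (hF.intervalIntegrable 0 1).1 (Filter.Eventually.of_forall h0)]
  exact lintegral_congr fun t => (Real.enorm_of_nonneg (h0 t)).symm

section AbsRpowIntegral

variable {V : Type*} [NormedAddCommGroup V] [InnerProductSpace ℝ V] [FiniteDimensional ℝ V]
  [MeasurableSpace V] [BorelSpace V] {f : SchwartzMap V ℝ} {q : ℝ}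

/-- The `L²` modulus of continuity of `|f| ^ q` is controlled by its derivative. -/
theorem SchwartzMap.lintegral_enorm_abs_rpow_sub_sq_le (f : SchwartzMap V ℝ) (hq : 1 ≤ q) (v : V) :
    ∫⁻ x, ‖|f (x + v)| ^ q - |f x| ^ q‖ₑ ^ 2 ≤ ∫⁻ x, ‖f.absRpowDeriv q v x‖ₑ ^ 2 := by
  have hW := f.continuous_absRpowDeriv hq v
  calc ∫⁻ x, ‖|f (x + v)| ^ q - |f x| ^ q‖ₑ ^ 2
      ≤ ∫⁻ x, ∫⁻ t in Set.Ioc (0 : ℝ) 1, ‖f.absRpowDeriv q v (x + t • v)‖ₑ ^ 2 := by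
        refine lintegral_mono fun x => ?_
        have h1 : ‖|f (x + v)| ^ q - |f x| ^ q‖ₑ ≤
            ∫⁻ t in Set.Ioc (0 : ℝ) 1, ‖f.absRpowDeriv q v (x + t • v)‖ₑ := by
          rw [← ofReal_intervalIntegral_eq_lintegral (by fun_prop)
            fun t => f.absRpowDeriv_nonneg hq _ _, Real.enorm_eq_ofReal_abs]
          exact ENNReal.ofReal_le_ofReal (f.abs_abs_rpow_sub_le hq x v)
        have h2 := lintegral_mul_rpow_le (μ := volume.restrict (Set.Ioc (0 : ℝ) 1))
          (K := fun _ => 1) (Φ := fun t => ‖f.absRpowDeriv q v (x + t • v)‖ₑ)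
          (by fun_prop) (by fun_prop) one_le_two
        simp only [one_mul, ENNReal.rpow_two, lintegral_const, Measure.restrict_apply_univ,
          Real.volume_Ioc, sub_zero, ENNReal.ofReal_one, ENNReal.one_rpow] at h2
        exact (pow_le_pow_left' h1 2).trans h2
    _ = ∫⁻ t in Set.Ioc (0 : ℝ) 1, ∫⁻ x, ‖f.absRpowDeriv q v (x + t • v)‖ₑ ^ 2 :=
        lintegral_lintegral_swap (by fun_prop)
    _ = ∫⁻ x, ‖f.absRpowDeriv q v x‖ₑ ^ 2 := by
        refine (lintegral_congr fun t => lintegral_add_right_eq_self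
          (fun x => ‖f.absRpowDeriv q v x‖ₑ ^ 2) (t • v)).trans ?_
        simp

theorem SchwartzMap.lintegral_enorm_absRpowDeriv_sq_le (hq : 1 ≤ q) {v : V} {M : ℝ≥0∞}
    (hM : ∫⁻ x, ‖fderiv ℝ f x v‖ₑ ^ (2 * q) ≤ M ^ (2 * q) * ∫⁻ x, ‖f x‖ₑ ^ (2 * q)) :
    ∫⁻ x, ‖f.absRpowDeriv q v x‖ₑ ^ 2 ≤
      (ENNReal.ofReal q * M) ^ 2 * ∫⁻ x, ‖f x‖ₑ ^ (2 * q) := by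
  have hq0 : 0 < q := by linarith
  have hq1 : 0 ≤ (q - 1) / q := div_nonneg (by linarith) hq0.le
  have hadd : (q - 1) / q + 1 / q = 1 := by field_simp; ring
  have hf := f.continuous
  have hd := f.continuous_fderiv_apply v
  have hpt : ∀ x, ‖f.absRpowDeriv q v x‖ₑ ^ 2 = ENNReal.ofReal q ^ 2 *
      ((‖f x‖ₑ ^ (2 * q)) ^ ((q - 1) / q) * (‖fderiv ℝ f x v‖ₑ ^ (2 * q)) ^ (1 / q)) := fun x => by
    have e1 : 2 * q * ((q - 1) / q) = (q - 1) * (2 : ℕ) := by push_cast; field_simp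
    have e2 : 2 * q * (1 / q) = (2 : ℕ) := by field_simp; norm_num
    rw [absRpowDeriv, enorm_mul, enorm_mul, Real.enorm_of_nonneg hq0.le, Real.enorm_abs,
      Real.enorm_rpow_of_nonneg (abs_nonneg _) (by linarith), Real.enorm_abs,
      ← ENNReal.rpow_mul, ← ENNReal.rpow_mul, e1, e2, ENNReal.rpow_mul, ENNReal.rpow_natCast,
      ENNReal.rpow_natCast]
    ring
  simp_rw [hpt]
  rw [lintegral_const_mul _ (by fun_prop), mul_pow, mul_assoc]
  gcongr
  calc ∫⁻ x, (‖f x‖ₑ ^ (2 * q)) ^ ((q - 1) / q) * (‖fderiv ℝ f x v‖ₑ ^ (2 * q)) ^ (1 / q)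
      ≤ (∫⁻ x, ‖f x‖ₑ ^ (2 * q)) ^ ((q - 1) / q) *
          (∫⁻ x, ‖fderiv ℝ f x v‖ₑ ^ (2 * q)) ^ (1 / q) :=
        ENNReal.lintegral_mul_norm_pow_le (by fun_prop) (by fun_prop) hq1 (by positivity) hadd
    _ ≤ (∫⁻ x, ‖f x‖ₑ ^ (2 * q)) ^ ((q - 1) / q) *
          (M ^ (2 * q) * ∫⁻ x, ‖f x‖ₑ ^ (2 * q)) ^ (1 / q) := by gcongr
    _ = M ^ 2 * ∫⁻ x, ‖f x‖ₑ ^ (2 * q) := by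
        rw [ENNReal.mul_rpow_of_nonneg _ _ (by positivity), ← ENNReal.rpow_mul, mul_left_comm,
          ← ENNReal.rpow_add_of_nonneg _ _ hq1 (by positivity), hadd, ENNReal.rpow_one]
        congr 1
        rw [← ENNReal.rpow_two]
        congr 1
        field_simp

theorem SchwartzMap.lintegral_enorm_abs_rpow_sq (hq : 1 ≤ q) :
    ∫⁻ x, ‖|f x| ^ q‖ₑ ^ 2 = ∫⁻ x, ‖f x‖ₑ ^ (2 * q) := by
  refine lintegral_congr fun x => ?_
  rw [Real.enorm_rpow_of_nonneg (abs_nonneg _) (by linarith), Real.enorm_abs, mul_comm,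
    ENNReal.rpow_mul, ENNReal.rpow_two]

theorem SchwartzMap.lintegral_abs_rpow_mul_sub_le (hq : 1 ≤ q) {v : V} {S T : ℝ≥0∞}
    (hS : ∀ t ∈ Set.Icc (0 : ℝ) 1, ∫⁻ x, ‖|f (x + t • v)| ^ q - |f x| ^ q‖ₑ ^ 2 ≤ S ^ 2)
    (hT : ∫⁻ x, ‖f.absRpowDeriv q v x‖ₑ ^ 2 ≤ T ^ 2) :
    ∫⁻ x, ‖|f x| ^ q‖ₑ * (‖|f x| ^ (q - 1)‖ₑ * ‖f (x + v) - f x‖ₑ) ≤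
      S * (2 * (∫⁻ x, ‖f x‖ₑ ^ (2 * q)) ^ (1 / 2 : ℝ) + 8 * T) := by
  have hW := f.continuous_absRpowDeriv hq v
  have hg := f.continuous_abs_rpow (q := q) (by linarith)
  have hf := f.continuous
  have hsqrt : ∀ {a b : ℝ≥0∞}, a ≤ b ^ 2 → a ^ (1 / 2 : ℝ) ≤ b := fun {a b} h => by
    refine (ENNReal.rpow_le_rpow h (by norm_num)).trans_eq ?_
    rw [← ENNReal.rpow_two, ← ENNReal.rpow_mul]
    norm_num
  have hgv : ∀ w : V, Continuous fun x => |f (x + w)| ^ q := fun w =>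
    hg.comp (continuous_add_const w)
  have hmeas : Measurable fun z : V × ℝ => ‖|f (z.1 + z.2 • v)| ^ q - |f z.1| ^ q‖ₑ *
      ‖f.absRpowDeriv q v (z.1 + z.2 • v)‖ₑ :=
    ((hg.comp (by fun_prop : Continuous fun z : V × ℝ => z.1 + z.2 • v)).sub
      (hg.comp continuous_fst)).enorm.measurable.mul
      (hW.comp (by fun_prop : Continuous fun z : V × ℝ => z.1 + z.2 • v)).enorm.measurable
  have hpt : ∀ x, ‖|f x| ^ q‖ₑ * (‖|f x| ^ (q - 1)‖ₑ * ‖f (x + v) - f x‖ₑ) ≤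
      2 * (‖|f x| ^ q‖ₑ * ‖|f (x + v)| ^ q - |f x| ^ q‖ₑ) +
      8 * ∫⁻ t in Set.Ioc (0 : ℝ) 1, ‖|f (x + t • v)| ^ q - |f x| ^ q‖ₑ *
          ‖f.absRpowDeriv q v (x + t • v)‖ₑ := fun x => by
    have hgx : Continuous fun t : ℝ => |f (x + t • v)| ^ q := hg.comp (by fun_prop)
    have h0 : ∀ t : ℝ, 0 ≤ |(|f (x + t • v)| ^ q - |f x| ^ q)| *
          f.absRpowDeriv q v (x + t • v) := fun t =>
      mul_nonneg (abs_nonneg _) (f.absRpowDeriv_nonneg hq _ _)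
    have h := ENNReal.ofReal_le_ofReal (f.abs_rpow_mul_abs_rpow_mul_abs_sub_le hq x v)
    rw [ENNReal.ofReal_add (by positivity) (mul_nonneg (by norm_num)
        (intervalIntegral.integral_nonneg zero_le_one fun t _ => h0 t)),
      ENNReal.ofReal_mul (by norm_num : (0 : ℝ) ≤ 8),
      ofReal_intervalIntegral_eq_lintegral (by fun_prop) h0,
      ENNReal.ofReal_mul (by norm_num : (0 : ℝ) ≤ 2), ENNReal.ofReal_mul (by positivity),
      ENNReal.ofReal_mul (by positivity), ENNReal.ofReal_mul (by positivity),
      ← Real.enorm_eq_ofReal_abs, ← Real.enorm_eq_ofReal_abs,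
      ← Real.enorm_of_nonneg (by positivity : 0 ≤ |f x| ^ q),
      ← Real.enorm_of_nonneg (by positivity : 0 ≤ |f x| ^ (q - 1))] at h
    simpa [enorm_mul] using h
  refine (lintegral_mono hpt).trans ?_
  rw [lintegral_add_left (by fun_prop), lintegral_const_mul _ (by fun_prop),
    lintegral_const_mul _ hmeas.lintegral_prod_right', lintegral_lintegral_swap hmeas.aemeasurable,
    mul_add]
  refine add_le_add ?_ ?_
  · rw [mul_left_comm]
    gcongr
    refine (lintegral_mul_le_sqrt_mul_sqrt (by fun_prop) (by fun_prop)).trans ?_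
    rw [mul_comm, lintegral_enorm_abs_rpow_sq hq]
    gcongr
    exact hsqrt (by simpa using hS 1 (by simp))
  · rw [mul_left_comm]
    gcongr
    calc ∫⁻ t in Set.Ioc (0 : ℝ) 1, ∫⁻ x, ‖|f (x + t • v)| ^ q - |f x| ^ q‖ₑ *
          ‖f.absRpowDeriv q v (x + t • v)‖ₑ
        ≤ ∫⁻ t in Set.Ioc (0 : ℝ) 1, S * T := by
          refine setLIntegral_mono measurable_const fun t ht => ?_
          refine (lintegral_mul_le_sqrt_mul_sqrt (by fun_prop) (by fun_prop)).trans ?_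
          rw [lintegral_add_right_eq_self (fun x => ‖f.absRpowDeriv q v x‖ₑ ^ 2) (t • v)]
          exact mul_le_mul' (hsqrt (hS t (Set.Ioc_subset_Icc_self ht))) (hsqrt hT)
      _ = S * T := by simp

end AbsRpowIntegral

section FractionalDerivative

variable {V : Type*} [NormedAddCommGroup V] [InnerProductSpace ℝ V] {α : ℝ}

theorem norm_fourierChar_inner_sub_one_le (hα : α ∈ Set.Icc (0 : ℝ) 1) (h ξ : V) :
    ‖((Real.fourierChar (inner ℝ h ξ) : Circle) : ℂ) - 1‖ ≤
      2 * (‖h‖ * (2 * Real.pi * ‖ξ‖)) ^ α := by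
  set θ : ℝ := 2 * Real.pi * inner ℝ h ξ
  have hθ : |θ| ≤ ‖h‖ * (2 * Real.pi * ‖ξ‖) := by
    rw [abs_mul, abs_of_pos Real.two_pi_pos, mul_left_comm]
    gcongr
    exact abs_real_inner_le_norm h ξ
  refine le_trans ?_ (mul_le_mul_of_nonneg_left
    (Real.rpow_le_rpow (abs_nonneg θ) hθ hα.1) zero_le_two)
  rw [Real.fourierChar_apply]
  rcases le_total |θ| 1 with h1 | h1
  · have h2 := Real.norm_exp_I_mul_ofReal_sub_one_le (x := θ)
    rw [mul_comm Complex.I, Real.norm_eq_abs] at h2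
    have h3 : |θ| ≤ |θ| ^ α := by
      simpa using Real.rpow_le_rpow_of_exponent_ge' (abs_nonneg θ) h1 hα.1 hα.2
    have := Real.rpow_nonneg (abs_nonneg θ) α
    linarith
  · refine (norm_sub_le _ _).trans ?_
    rw [Complex.norm_exp_ofReal_mul_I, norm_one]
    have := Real.one_le_rpow h1 hα.1
    linarith

theorem rpow_two_mul_le_one_add_sq (hα : α ∈ Set.Icc (0 : ℝ) 1) {y : ℝ} (hy : 0 ≤ y) :
    y ^ (2 * α) ≤ 1 + y ^ 2 := by
  rcases le_total y 1 with h | h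
  · nlinarith [Real.rpow_le_one hy h (by linarith [hα.1] : 0 ≤ 2 * α)]
  · have := Real.rpow_le_rpow_of_exponent_le h (by linarith [hα.2] : 2 * α ≤ 2)
    rw [Real.rpow_two] at this
    linarith

variable [FiniteDimensional ℝ V] [MeasurableSpace V] [BorelSpace V] {u : V → ℂ}

/-- The `L²` modulus of continuity is controlled by the fractional derivative. -/
theorem lintegral_enorm_comp_add_right_sub_sq_le (hα : α ∈ Set.Icc (0 : ℝ) 1)
    (h1 : Integrable u) (h2 : MemLp u 2) (h : V) :
    ∫⁻ x, ‖u (x + h) - u x‖ₑ ^ 2 ≤ ENNReal.ofReal (2 * ‖h‖ ^ α) ^ 2 *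
      ∫⁻ ξ, ENNReal.ofReal ((2 * Real.pi * ‖ξ‖) ^ (2 * α) * ‖𝓕 u ξ‖ ^ 2) := by
  rw [lintegral_enorm_comp_add_right_sub_sq h1 h2,
    ← lintegral_const_mul' _ _ (ENNReal.pow_ne_top ENNReal.ofReal_ne_top)]
  refine lintegral_mono fun ξ => ?_
  rw [← ofReal_norm, ← ofReal_norm, ← ENNReal.ofReal_pow (by positivity),
    ← ENNReal.ofReal_pow (by positivity), ← ENNReal.ofReal_pow (by positivity),
    ← ENNReal.ofReal_mul (by positivity), ← ENNReal.ofReal_mul (by positivity)]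
  refine ENNReal.ofReal_le_ofReal ?_
  have e : (2 * Real.pi * ‖ξ‖) ^ (2 * α) = ((2 * Real.pi * ‖ξ‖) ^ α) ^ 2 := by
    rw [← Real.rpow_natCast, ← Real.rpow_mul (by positivity), mul_comm 2 α]
    norm_num
  refine (mul_le_mul_of_nonneg_right (pow_le_pow_left₀ (norm_nonneg _)
    (norm_fourierChar_inner_sub_one_le hα h ξ) 2) (by positivity)).trans_eq ?_
  rw [e, Real.mul_rpow (by positivity) (by positivity)]
  ring

/-- Converse to the control of difference quotients by derivatives, on the Fourier side. -/
theorem lintegral_inner_sq_mul_enorm_fourier_sq_le (h1 : Integrable u) (h2 : MemLp u 2) {v : V}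
    {T : ℝ≥0∞} (hT : ∀ ε : ℝ, 0 < ε →
      ∫⁻ x, ‖u (x + ε • v) - u x‖ₑ ^ 2 ≤ ENNReal.ofReal ε ^ 2 * T) :
    ∫⁻ ξ, ENNReal.ofReal ((2 * Real.pi * inner ℝ v ξ) ^ 2) * ‖𝓕 u ξ‖ₑ ^ 2 ≤ T := by
  have hcont := h1.continuous_fourier
  have hchar : Continuous fun y : ℝ => ((Real.fourierChar y : Circle) : ℂ) :=
    continuous_subtype_val.comp Real.continuous_fourierChar
  let ε : ℕ → ℝ := fun n => 1 / ((n : ℝ) + 1)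
  have hε : ∀ n, 0 < ε n := fun n => by positivity
  have hε0 : Filter.Tendsto ε Filter.atTop (nhdsWithin 0 (Set.Ioi 0)) :=
    tendsto_nhdsWithin_iff.2 ⟨tendsto_one_div_add_atTop_nhds_zero_nat,
      Filter.Eventually.of_forall fun n => hε n⟩
  let F : ℕ → V → ℝ≥0∞ := fun n ξ =>
    ‖(ε n)⁻¹ • (((Real.fourierChar (inner ℝ (ε n • v) ξ) : Circle) : ℂ) - 1)‖ₑ ^ 2 * ‖𝓕 u ξ‖ₑ ^ 2
  have hF : ∀ n, Measurable (F n) := fun n => by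
    have : Continuous fun ξ : V => ((Real.fourierChar (inner ℝ (ε n • v) ξ) : Circle) : ℂ) :=
      hchar.comp (by fun_prop)
    fun_prop
  have hFT : ∀ n, ∫⁻ ξ, F n ξ ≤ T := fun n => by
    have e : ∀ ξ, F n ξ = ENNReal.ofReal (ε n)⁻¹ ^ 2 *
        (‖((Real.fourierChar (inner ℝ (ε n • v) ξ) : Circle) : ℂ) - 1‖ₑ ^ 2 * ‖𝓕 u ξ‖ₑ ^ 2) :=
      fun ξ => by
        simp only [F]
        rw [enorm_smul, Real.enorm_of_nonneg (inv_pos.2 (hε n)).le]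
        ring
    rw [lintegral_congr e, lintegral_const_mul' _ _ (by simp),
      ← lintegral_enorm_comp_add_right_sub_sq h1 h2]
    refine (mul_le_mul_right (hT _ (hε n)) _).trans_eq ?_
    rw [← mul_assoc, ← mul_pow, ← ENNReal.ofReal_mul (inv_pos.2 (hε n)).le,
      inv_mul_cancel₀ (hε n).ne']
    simp
  have hlim : ∀ ξ, Filter.liminf (fun n => F n ξ) Filter.atTop =
      ENNReal.ofReal ((2 * Real.pi * inner ℝ v ξ) ^ 2) * ‖𝓕 u ξ‖ₑ ^ 2 := fun ξ => by
    refine Filter.Tendsto.liminf_eq (ENNReal.Tendsto.mul_const ?_ (Or.inr (by simp)))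
    have hd : HasDerivAt (fun t : ℝ => ((Real.fourierChar (t * inner ℝ v ξ) : Circle) : ℂ))
        (2 * Real.pi * Complex.I * inner ℝ v ξ) 0 := by
      have := (Real.hasDerivAt_fourierChar (0 * inner ℝ v ξ)).scomp (0 : ℝ)
        ((hasDerivAt_id (0 : ℝ)).mul_const (inner ℝ v ξ))
      refine this.congr_deriv ?_
      simp
      ring
    have ht := ENNReal.Tendsto.pow (n := 2) (hd.tendsto_slope_zero_right.comp hε0).enorm
    have e : ‖(2 * Real.pi * Complex.I * inner ℝ v ξ : ℂ)‖ₑ ^ 2 =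
        ENNReal.ofReal ((2 * Real.pi * inner ℝ v ξ) ^ 2) := by
      rw [← ofReal_norm, ← ENNReal.ofReal_pow (norm_nonneg _)]
      congr 1
      simp [mul_pow]
    rw [e] at ht
    simpa [Function.comp_def, inner_smul_left] using ht
  calc _ = ∫⁻ ξ, Filter.liminf (fun n => F n ξ) Filter.atTop :=
        (lintegral_congr hlim).symm
    _ ≤ Filter.liminf (fun n => ∫⁻ ξ, F n ξ) Filter.atTop := lintegral_liminf_le hF
    _ ≤ Filter.liminf (fun _ : ℕ => T) Filter.atTop :=
        Filter.liminf_le_liminf (Filter.Eventually.of_forall hFT)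
    _ = T := Filter.liminf_const T

/-- A fractional derivative is controlled by the function and its first order differences. -/
theorem lintegral_rpow_mul_fourier_sq_le (hα : α ∈ Set.Icc (0 : ℝ) 1)
    (h1 : Integrable u) (h2 : MemLp u 2) {l : ℝ} (hl : 0 < l) {A : ℝ≥0∞}
    (hA : ∀ v, ∫⁻ x, ‖u (x + v) - u x‖ₑ ^ 2 ≤ (ENNReal.ofReal l * ‖v‖ₑ) ^ 2 * A) :
    ∫⁻ ξ, ENNReal.ofReal ((2 * Real.pi * ‖ξ‖) ^ (2 * α) * ‖𝓕 u ξ‖ ^ 2) ≤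
      ENNReal.ofReal (l ^ (2 * α)) * ((∫⁻ x, ‖u x‖ₑ ^ 2) + Module.finrank ℝ V * A) := by
  have hcont := h1.continuous_fourier
  let b := stdOrthonormalBasis ℝ V
  have hT : ∀ i, ∫⁻ ξ, ENNReal.ofReal ((2 * Real.pi * inner ℝ (b i) ξ) ^ 2) * ‖𝓕 u ξ‖ₑ ^ 2 ≤
      ENNReal.ofReal l ^ 2 * A := fun i => by
    refine lintegral_inner_sq_mul_enorm_fourier_sq_le h1 h2 fun ε hε => (hA _).trans_eq ?_
    rw [enorm_smul, Real.enorm_of_nonneg hε.le, ← ofReal_norm (b i), b.norm_eq_one]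
    simp only [ENNReal.ofReal_one]
    ring
  have hpt : ∀ ξ, ENNReal.ofReal ((2 * Real.pi * ‖ξ‖) ^ (2 * α) * ‖𝓕 u ξ‖ ^ 2) ≤
      ENNReal.ofReal (l ^ (2 * α)) * (‖𝓕 u ξ‖ₑ ^ 2 + ENNReal.ofReal l⁻¹ ^ 2 *
        ∑ i, ENNReal.ofReal ((2 * Real.pi * inner ℝ (b i) ξ) ^ 2) * ‖𝓕 u ξ‖ₑ ^ 2) := fun ξ => by
    have hsum : ∑ i, (2 * Real.pi * inner ℝ (b i) ξ) ^ 2 = (2 * Real.pi * ‖ξ‖) ^ 2 := by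
      simp_rw [mul_pow _ (inner ℝ _ _), mul_pow _ ‖ξ‖, ← Finset.mul_sum]
      rw [← b.sum_sq_norm_inner_right ξ]
      simp
    have hy := rpow_two_mul_le_one_add_sq hα (y := l⁻¹ * (2 * Real.pi * ‖ξ‖)) (by positivity)
    have hy' : (2 * Real.pi * ‖ξ‖) ^ (2 * α) ≤
        l ^ (2 * α) * (1 + l⁻¹ ^ 2 * (2 * Real.pi * ‖ξ‖) ^ 2) := by
      rw [← mul_pow]
      refine le_trans (le_of_eq ?_) (mul_le_mul_of_nonneg_left hy (by positivity))
      rw [← Real.mul_rpow hl.le (by positivity), mul_inv_cancel_left₀ hl.ne']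
    rw [← Finset.sum_mul, ← ENNReal.ofReal_sum_of_nonneg fun i _ => by positivity, hsum,
      ← ofReal_norm, ← ENNReal.ofReal_pow (by positivity), ← ENNReal.ofReal_pow (by positivity),
      ← ENNReal.ofReal_mul (by positivity), ← ENNReal.ofReal_mul (by positivity),
      ← ENNReal.ofReal_add (by positivity) (by positivity), ← ENNReal.ofReal_mul (by positivity)]
    refine ENNReal.ofReal_le_ofReal ?_
    refine (mul_le_mul_of_nonneg_right hy' (by positivity)).trans_eq ?_
    ring
  refine (lintegral_mono hpt).trans ?_
  rw [lintegral_const_mul _ (by fun_prop), lintegral_add_left (by fun_prop),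
    lintegral_const_mul _ (by fun_prop), lintegral_finsetSum _ (by fun_prop),
    lintegral_enorm_fourier_sq h1 h2]
  refine mul_le_mul_right (add_le_add_right ?_ _) _
  calc ENNReal.ofReal l⁻¹ ^ 2 *
        ∑ i, ∫⁻ ξ, ENNReal.ofReal ((2 * Real.pi * inner ℝ (b i) ξ) ^ 2) * ‖𝓕 u ξ‖ₑ ^ 2
      ≤ ENNReal.ofReal l⁻¹ ^ 2 * ∑ _i : Fin (Module.finrank ℝ V), ENNReal.ofReal l ^ 2 * A := by
        gcongr with i
        exact hT i
    _ = Module.finrank ℝ V * A := by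
        rw [Finset.sum_const, Finset.card_univ, Fintype.card_fin, nsmul_eq_mul, mul_left_comm,
          ← mul_assoc (ENNReal.ofReal l⁻¹ ^ 2), ← mul_pow,
          ← ENNReal.ofReal_mul (inv_pos.2 hl).le, inv_mul_cancel₀ hl.ne']
        simp

end FractionalDerivative

section Bernstein

variable {V : Type*} [NormedAddCommGroup V] [InnerProductSpace ℝ V] [FiniteDimensional ℝ V]
  [MeasurableSpace V] [BorelSpace V] {f : SchwartzMap V ℝ} {q α l : ℝ}

theorem SchwartzMap.integrable_ofReal_abs_rpow (f : SchwartzMap V ℝ) (hq : 1 ≤ q) :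
    Integrable fun y => ((|f y| ^ q : ℝ) : ℂ) := by
  have h := (f.memLp (ENNReal.ofReal q) volume).integrable_norm_rpow
    (by simp; linarith) ENNReal.ofReal_ne_top
  rw [ENNReal.toReal_ofReal (by linarith)] at h
  exact h.ofReal

theorem SchwartzMap.memLp_ofReal_abs_rpow (f : SchwartzMap V ℝ) (hq : 1 ≤ q) :
    MemLp (fun y => ((|f y| ^ q : ℝ) : ℂ)) 2 := by
  have h := (f.memLp (ENNReal.ofReal (2 * q)) volume).norm_rpow_div (ENNReal.ofReal q)
  rw [ENNReal.toReal_ofReal (by linarith), ENNReal.ofReal_mul zero_le_two,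
    ENNReal.mul_div_cancel_right (by simp; linarith) ENNReal.ofReal_ne_top,
    ENNReal.ofReal_ofNat] at h
  exact h.ofReal

theorem SchwartzMap.lintegral_enorm_rpow_lt_top (f : SchwartzMap V ℝ) (hq : 1 ≤ q) :
    ∫⁻ x, ‖f x‖ₑ ^ (2 * q) < ∞ := by
  have := lintegral_rpow_enorm_lt_top_of_eLpNorm_lt_top (by simp; linarith) ENNReal.ofReal_ne_top
    (f.memLp (ENNReal.ofReal (2 * q)) volume).2
  rwa [ENNReal.toReal_ofReal (by linarith)] at this

theorem SchwartzMap.lintegral_enorm_weight_lt_top (ψ : SchwartzMap V ℂ) (hα : α ∈ Set.Icc (0 : ℝ) 1)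
    {A : ℝ≥0∞} (hA : A ≠ ∞) :
    ∫⁻ k, ‖ψ k‖ₑ * (ENNReal.ofReal (2 * ‖k‖ ^ α) * (2 + A * ‖k‖ₑ)) < ∞ := by
  have hint : Integrable fun k => ‖k‖ ^ 0 * ‖ψ k‖ + 2 * (‖k‖ ^ 1 * ‖ψ k‖) + ‖k‖ ^ 2 * ‖ψ k‖ :=
    ((ψ.integrable_pow_mul volume 0).add ((ψ.integrable_pow_mul volume 1).const_mul 2)).add
      (ψ.integrable_pow_mul volume 2)
  have hfin : ∫⁻ k, 2 * (2 + A) * ENNReal.ofReal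
      (‖k‖ ^ 0 * ‖ψ k‖ + 2 * (‖k‖ ^ 1 * ‖ψ k‖) + ‖k‖ ^ 2 * ‖ψ k‖) < ∞ := by
    rw [lintegral_const_mul' _ _ (by finiteness)]
    exact ENNReal.mul_lt_top (by finiteness) hint.lintegral_lt_top
  refine (lintegral_mono fun k => ?_).trans_lt hfin
  have hk : ‖k‖ ^ α ≤ 1 + ‖k‖ := by
    rcases le_total ‖k‖ 1 with h | h
    · linarith [Real.rpow_le_one (norm_nonneg k) h hα.1, norm_nonneg k]
    · have := Real.rpow_le_rpow_of_exponent_le h hα.2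
      rw [Real.rpow_one] at this
      linarith
  have h1 : ENNReal.ofReal (2 * ‖k‖ ^ α) ≤ 2 * ENNReal.ofReal (1 + ‖k‖) := by
    rw [← ENNReal.ofReal_ofNat 2, ← ENNReal.ofReal_mul zero_le_two]
    exact ENNReal.ofReal_le_ofReal (by linarith)
  have h2 : 2 + A * ‖k‖ₑ ≤ (2 + A) * ENNReal.ofReal (1 + ‖k‖) := by
    rw [ENNReal.ofReal_add zero_le_one (norm_nonneg k), ofReal_norm, ENNReal.ofReal_one, add_mul,
      mul_add, mul_add, mul_one, mul_one]
    exact add_le_add le_self_add le_add_self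
  calc ‖ψ k‖ₑ * (ENNReal.ofReal (2 * ‖k‖ ^ α) * (2 + A * ‖k‖ₑ))
      ≤ ‖ψ k‖ₑ * (2 * ENNReal.ofReal (1 + ‖k‖) * ((2 + A) * ENNReal.ofReal (1 + ‖k‖))) := by
        gcongr
    _ = 2 * (2 + A) * (ENNReal.ofReal (1 + ‖k‖) * ENNReal.ofReal (1 + ‖k‖) * ‖ψ k‖ₑ) := by ring
    _ = _ := by
        rw [← ofReal_norm (ψ k), ← ENNReal.ofReal_mul (by positivity),
          ← ENNReal.ofReal_mul (by positivity)]
        congr 2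
        ring

theorem SchwartzMap.lintegral_enorm_abs_rpow_comp_add_sub_sq_le (hq : 1 ≤ q) {B : ℝ≥0∞}
    (hB : ∀ v, ∫⁻ x, ‖fderiv ℝ f x v‖ₑ ^ (2 * q) ≤
      (ENNReal.ofReal l * ‖v‖ₑ * B) ^ (2 * q) * ∫⁻ x, ‖f x‖ₑ ^ (2 * q)) (v : V) :
    ∫⁻ x, ‖((|f (x + v)| ^ q : ℝ) : ℂ) - ((|f x| ^ q : ℝ) : ℂ)‖ₑ ^ 2 ≤
      (ENNReal.ofReal l * ‖v‖ₑ) ^ 2 *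
        ((ENNReal.ofReal q * B) ^ 2 * ∫⁻ x, ‖f x‖ₑ ^ (2 * q)) := by
  simp_rw [← Complex.ofReal_sub, ← ofReal_norm (E := ℂ), Complex.norm_real, ofReal_norm]
  refine (f.lintegral_enorm_abs_rpow_sub_sq_le hq v).trans
    ((lintegral_enorm_absRpowDeriv_sq_le hq (hB v)).trans_eq ?_)
  ring

/-- A reproducing formula with a mean zero kernel bounds the norm of `f` by a fractional derivative
of `|f| ^ q`. -/
theorem SchwartzMap.lintegral_enorm_rpow_le_of_reproducing (hq : 1 ≤ q)
    (hα : α ∈ Set.Icc (0 : ℝ) 1) (hl : 0 < l) {ψ : SchwartzMap V ℂ} (hψ0 : ∫ k, ψ k = 0)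
    (hψ : ∀ x, (f x : ℂ) = ∫ k, ψ k * f (x - l⁻¹ • k)) {B : ℝ≥0∞}
    (hB : ∀ v, ∫⁻ x, ‖fderiv ℝ f x v‖ₑ ^ (2 * q) ≤
      (ENNReal.ofReal l * ‖v‖ₑ * B) ^ (2 * q) * ∫⁻ x, ‖f x‖ₑ ^ (2 * q)) :
    ENNReal.ofReal (l ^ (2 * α)) * ∫⁻ x, ‖f x‖ₑ ^ (2 * q) ≤
      (∫⁻ k, ‖ψ k‖ₑ * (ENNReal.ofReal (2 * ‖k‖ ^ α) * (2 + 8 * ENNReal.ofReal q * B * ‖k‖ₑ))) ^ 2 *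
      ∫⁻ ξ, ENNReal.ofReal ((2 * Real.pi * ‖ξ‖) ^ (2 * α) *
        ‖𝓕 (fun y => ((|f y| ^ q : ℝ) : ℂ)) ξ‖ ^ 2) := by
  have hNtop := f.lintegral_enorm_rpow_lt_top hq
  set N := ∫⁻ x, ‖f x‖ₑ ^ (2 * q) with hN
  set E := ∫⁻ ξ, ENNReal.ofReal ((2 * Real.pi * ‖ξ‖) ^ (2 * α) *
    ‖𝓕 (fun y => ((|f y| ^ q : ℝ) : ℂ)) ξ‖ ^ 2) with hE
  set K := ∫⁻ k, ‖ψ k‖ₑ * (ENNReal.ofReal (2 * ‖k‖ ^ α) *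
    (2 + 8 * ENNReal.ofReal q * B * ‖k‖ₑ)) with hK
  have hsq : ∀ a : ℝ≥0∞, (a ^ (1 / 2 : ℝ)) ^ 2 = a := fun a => by
    rw [← ENNReal.rpow_two, ← ENNReal.rpow_mul]
    norm_num
  have hf := f.continuous
  have hψc := ψ.continuous
  have hg := f.continuous_abs_rpow (q := q) (by linarith)
  have hg1 := f.continuous_abs_rpow (q := q - 1) (by linarith)
  have hrep : ∀ x, ‖f x‖ₑ ≤ ∫⁻ k, ‖ψ k‖ₑ * ‖f (x + -(l⁻¹ • k)) - f x‖ₑ := fun x => by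
    have hi : Integrable fun k => ψ k * (f (x - l⁻¹ • k) : ℂ) := by
      have hb := f.toBoundedContinuousFunction.norm_coe_le_norm
      refine ψ.integrable.mul_bdd (c := ‖f.toBoundedContinuousFunction‖) (by fun_prop)
        (Filter.Eventually.of_forall fun k => ?_)
      rw [Complex.norm_real]
      exact hb _
    have e : (f x : ℂ) = ∫ k, ψ k * ((f (x + -(l⁻¹ • k)) - f x : ℝ) : ℂ) := by
      push_cast
      simp_rw [mul_sub, ← sub_eq_add_neg]
      rw [integral_sub hi (ψ.integrable.mul_const _), integral_mul_const, hψ0, zero_mul, sub_zero,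
        hψ x]
    have e2 : ‖f x‖ₑ = ‖(f x : ℂ)‖ₑ := by
      rw [← ofReal_norm, ← ofReal_norm, Complex.norm_real]
    rw [e2, e]
    refine (enorm_integral_le_lintegral_enorm _).trans_eq (lintegral_congr fun k => ?_)
    rw [enorm_mul, ← ofReal_norm ((_ : ℝ) : ℂ), Complex.norm_real, ofReal_norm]
  have hinner : ∀ k, ∫⁻ x, ‖|f x| ^ q‖ₑ * (‖|f x| ^ (q - 1)‖ₑ * ‖f (x + -(l⁻¹ • k)) - f x‖ₑ) ≤
      ENNReal.ofReal (l⁻¹ ^ α) * N ^ (1 / 2 : ℝ) * E ^ (1 / 2 : ℝ) *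
        (ENNReal.ofReal (2 * ‖k‖ ^ α) * (2 + 8 * ENNReal.ofReal q * B * ‖k‖ₑ)) := fun k => by
    set v := -(l⁻¹ • k) with hv
    have hvn : ‖v‖ = l⁻¹ * ‖k‖ := by
      rw [hv, norm_neg, norm_smul, Real.norm_of_nonneg (inv_pos.2 hl).le]
    have hlv : ENNReal.ofReal l * ‖v‖ₑ = ‖k‖ₑ := by
      rw [← ofReal_norm, hvn, ← ENNReal.ofReal_mul hl.le, mul_inv_cancel_left₀ hl.ne', ofReal_norm]
    refine (lintegral_abs_rpow_mul_sub_le (f := f) hq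
      (S := ENNReal.ofReal (2 * ‖v‖ ^ α) * E ^ (1 / 2 : ℝ))
      (T := ENNReal.ofReal q * (‖k‖ₑ * B) * N ^ (1 / 2 : ℝ)) (fun t ht => ?_) ?_).trans_eq ?_
    · have h := lintegral_enorm_comp_add_right_sub_sq_le hα (f.integrable_ofReal_abs_rpow hq)
        (f.memLp_ofReal_abs_rpow hq) (t • v)
      simp_rw [← Complex.ofReal_sub, ← ofReal_norm (E := ℂ), Complex.norm_real, ofReal_norm] at h
      refine h.trans ?_
      rw [mul_pow, hsq]
      have htv : ‖t • v‖ ≤ ‖v‖ := by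
        rw [norm_smul, Real.norm_of_nonneg ht.1]
        exact mul_le_of_le_one_left (norm_nonneg _) ht.2
      gcongr
      exact hα.1
    · rw [mul_pow, hsq, ← hlv]
      exact lintegral_enorm_absRpowDeriv_sq_le hq (hB v)
    · rw [hvn, Real.mul_rpow (inv_pos.2 hl).le (norm_nonneg k), mul_left_comm,
        ENNReal.ofReal_mul (by positivity)]
      ring
  have hmain : N ≤ ENNReal.ofReal (l⁻¹ ^ α) * N ^ (1 / 2 : ℝ) * E ^ (1 / 2 : ℝ) * K := by
    calc N = ∫⁻ x, ‖|f x| ^ q‖ₑ * (‖|f x| ^ (q - 1)‖ₑ * ‖f x‖ₑ) := by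
          rw [hN, ← lintegral_enorm_abs_rpow_sq hq]
          refine lintegral_congr fun x => ?_
          rw [← enorm_mul, sq]
          congr 1
          rw [← abs_abs_rpow_mul_self hq, Real.enorm_abs]
      _ ≤ ∫⁻ x, ∫⁻ k, ‖ψ k‖ₑ *
            (‖|f x| ^ q‖ₑ * (‖|f x| ^ (q - 1)‖ₑ * ‖f (x + -(l⁻¹ • k)) - f x‖ₑ)) := by
          refine lintegral_mono fun x => ?_
          simp_rw [mul_left_comm ‖ψ _‖ₑ]
          rw [lintegral_const_mul _ (by fun_prop), lintegral_const_mul _ (by fun_prop)]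
          gcongr
          exact hrep x
      _ = ∫⁻ k, ∫⁻ x, ‖ψ k‖ₑ *
            (‖|f x| ^ q‖ₑ * (‖|f x| ^ (q - 1)‖ₑ * ‖f (x + -(l⁻¹ • k)) - f x‖ₑ)) :=
          lintegral_lintegral_swap (by fun_prop)
      _ ≤ ∫⁻ k, ENNReal.ofReal (l⁻¹ ^ α) * N ^ (1 / 2 : ℝ) * E ^ (1 / 2 : ℝ) * (‖ψ k‖ₑ *
            (ENNReal.ofReal (2 * ‖k‖ ^ α) * (2 + 8 * ENNReal.ofReal q * B * ‖k‖ₑ))) := by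
          refine lintegral_mono fun k => ?_
          rw [lintegral_const_mul _ (by fun_prop), mul_left_comm _ ‖ψ k‖ₑ]
          gcongr
          exact hinner k
      _ = _ := lintegral_const_mul _ (by fun_prop)
  rcases eq_or_ne N 0 with h0 | h0
  · simp [h0]
  · have hN2 : N = N ^ (1 / 2 : ℝ) * N ^ (1 / 2 : ℝ) := by rw [← sq, hsq]
    have hle : N ^ (1 / 2 : ℝ) ≤ ENNReal.ofReal (l⁻¹ ^ α) * E ^ (1 / 2 : ℝ) * K := by
      have h0' : N ^ (1 / 2 : ℝ) ≠ 0 := by simp [h0]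
      have ht' : N ^ (1 / 2 : ℝ) ≠ ∞ := by simp [hNtop.ne]
      refine (ENNReal.mul_le_mul_iff_right h0' ht').1 (hN2.symm.trans_le (hmain.trans_eq ?_))
      ring
    calc ENNReal.ofReal (l ^ (2 * α)) * N = ENNReal.ofReal (l ^ α) ^ 2 * (N ^ (1 / 2 : ℝ)) ^ 2 := by
          rw [hsq, ← ENNReal.ofReal_pow (by positivity), ← Real.rpow_natCast, ← Real.rpow_mul hl.le,
            mul_comm 2 α]
          norm_num
      _ ≤ ENNReal.ofReal (l ^ α) ^ 2 * (ENNReal.ofReal (l⁻¹ ^ α) * E ^ (1 / 2 : ℝ) * K) ^ 2 := by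
          gcongr
      _ = (ENNReal.ofReal (l ^ α) * ENNReal.ofReal (l⁻¹ ^ α)) ^ 2 *
            ((E ^ (1 / 2 : ℝ)) ^ 2 * K ^ 2) := by ring
      _ = K ^ 2 * E := by
          rw [hsq, ← ENNReal.ofReal_mul (by positivity),
            ← Real.mul_rpow hl.le (inv_pos.2 hl).le, mul_inv_cancel₀ hl.ne']
          simp [mul_comm]

end Bernstein

theorem SchwartzMap.enorm_fderiv_postcompCLM_ofRealCLM {V : Type*} [NormedAddCommGroup V]
    [NormedSpace ℝ V] (f : SchwartzMap V ℝ) (x v : V) :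
    ‖fderiv ℝ (f.postcompCLM Complex.ofRealCLM) x v‖ₑ = ‖fderiv ℝ f x v‖ₑ := by
  have h : HasFDerivAt (f.postcompCLM Complex.ofRealCLM)
      (Complex.ofRealCLM ∘L fderiv ℝ f x) x :=
    Complex.ofRealCLM.hasFDerivAt.comp x f.differentiable.differentiableAt.hasFDerivAt
  rw [h.fderiv, ← ofReal_norm, ← ofReal_norm]
  simp

/-- Bernstein-type inequality for fractional powers of `|f|^{p/2}`: if `𝓕f` is
supported in the annulus `{r₁ 2^j ≤ |ξ| ≤ r₂ 2^j}`, then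
`c 2^{2αj/p} ‖f‖_{L^p} ≤ (∫ (2π|ξ|)^{2α} |𝓕(|f|^{p/2})(ξ)|² dξ)^{1/p}
  ≤ C 2^{2αj/p} ‖f‖_{L^p}`. -/
theorem bernstein_fractional_power
    (d : ℕ) (hd : 1 ≤ d) (p : ℝ) (hp : 2 ≤ p) (α : ℝ) (hα : α ∈ Set.Icc (0 : ℝ) 1)
    (r₁ r₂ : ℝ) (hr₁ : 0 < r₁) (hr₂ : r₁ < r₂) :
    ∃ c > (0 : ℝ), ∃ C > (0 : ℝ), ∀ (j : ℤ) (f : SchwartzMap (EuclideanSpace ℝ (Fin d)) ℝ),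
      (Function.support (𝓕 (fun y : EuclideanSpace ℝ (Fin d) => ((f y : ℝ) : ℂ)))
          ⊆ {ξ : EuclideanSpace ℝ (Fin d) | r₁ * 2 ^ j ≤ ‖ξ‖ ∧ ‖ξ‖ ≤ r₂ * 2 ^ j}) →
      ENNReal.ofReal (c * (2 : ℝ) ^ (2 * α * (j : ℝ) / p))
            * eLpNorm (⇑f) (ENNReal.ofReal p) volume
          ≤ (∫⁻ ξ : EuclideanSpace ℝ (Fin d),
              ENNReal.ofReal ((2 * Real.pi * ‖ξ‖) ^ (2 * α)
                * ‖𝓕 (fun y : EuclideanSpace ℝ (Fin d) =>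
                    ((|f y| ^ (p / 2) : ℝ) : ℂ)) ξ‖ ^ 2)) ^ (1 / p)
        ∧ (∫⁻ ξ : EuclideanSpace ℝ (Fin d),
              ENNReal.ofReal ((2 * Real.pi * ‖ξ‖) ^ (2 * α)
                * ‖𝓕 (fun y : EuclideanSpace ℝ (Fin d) =>
                    ((|f y| ^ (p / 2) : ℝ) : ℂ)) ξ‖ ^ 2)) ^ (1 / p)
            ≤ ENNReal.ofReal (C * (2 : ℝ) ^ (2 * α * (j : ℝ) / p))
                * eLpNorm (⇑f) (ENNReal.ofReal p) volume := by
  obtain ⟨ψ, hψ0, hψ1⟩ :=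
    exists_schwartzMap_fourier_eq_one_on_annulus (V := EuclideanSpace ℝ (Fin d)) hr₁ hr₂
  set B := ∫⁻ k, ‖fderiv ℝ ψ k‖ₑ
  have hBtop : B ≠ ∞ := (SchwartzMap.fderivCLM ℝ _ ℂ ψ).integrable.2.ne
  set q := p / 2 with hqdef
  have hq : 1 ≤ q := by linarith
  have hpq : 2 * q = p := by ring
  have hp0 : 0 < p := by linarith
  set K := ∫⁻ k, ‖ψ k‖ₑ * (ENNReal.ofReal (2 * ‖k‖ ^ α) * (2 + 8 * ENNReal.ofReal q * B * ‖k‖ₑ))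
  have hK : K ≠ ∞ := (ψ.lintegral_enorm_weight_lt_top hα (by finiteness)).ne
  set D : ℝ≥0∞ := 1 + d * (ENNReal.ofReal q * B) ^ 2
  have hD : D ≠ ∞ := by finiteness
  have hD1 : 0 < D.toReal := ENNReal.toReal_pos (by simp [D]) hD
  refine ⟨((K.toReal + 1) ^ 2)⁻¹ ^ (1 / p), by positivity, D.toReal ^ (1 / p), by positivity,
    fun j f hsupp => ?_⟩
  set l : ℝ := 2 ^ j
  have hl : 0 < l := by positivity
  set fC := f.postcompCLM Complex.ofRealCLM
  have hmult : ∀ ξ, 𝓕 (fC : EuclideanSpace ℝ (Fin d) → ℂ) ξ ≠ 0 →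
      𝓕 (ψ : EuclideanSpace ℝ (Fin d) → ℂ) (l⁻¹ • ξ) = 1 := fun ξ hξ => by
    obtain ⟨ha, hb⟩ := hsupp hξ
    have hn : ‖l⁻¹ • ξ‖ = ‖ξ‖ / l := by
      rw [norm_smul, Real.norm_of_nonneg (inv_pos.2 hl).le, inv_mul_eq_div]
    exact hψ1 _ (by rwa [hn, le_div_iff₀ hl]) (by rwa [hn, div_le_iff₀ hl])
  have hfC : ∀ x, ‖fC x‖ₑ = ‖f x‖ₑ := fun x => by
    rw [← ofReal_norm, ← ofReal_norm]
    simp [fC]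
  have hB : ∀ v, ∫⁻ x, ‖fderiv ℝ f x v‖ₑ ^ (2 * q) ≤
      (ENNReal.ofReal l * ‖v‖ₑ * B) ^ (2 * q) * ∫⁻ x, ‖f x‖ₑ ^ (2 * q) := fun v => by
    simpa only [fC, f.enorm_fderiv_postcompCLM_ofRealCLM, hfC] using
      SchwartzMap.lintegral_enorm_fderiv_rpow_le hl hmult (by linarith : 1 ≤ 2 * q) v
  have hlow := SchwartzMap.lintegral_enorm_rpow_le_of_reproducing hq hα hl hψ0
    (SchwartzMap.reproducing_formula hmult) hB
  have hup := lintegral_rpow_mul_fourier_sq_le hα (f.integrable_ofReal_abs_rpow hq)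
    (f.memLp_ofReal_abs_rpow hq) hl (f.lintegral_enorm_abs_rpow_comp_add_sub_sq_le hq hB)
  have hu : ∀ x, ‖((|f x| ^ q : ℝ) : ℂ)‖ₑ = ‖|f x| ^ q‖ₑ := fun x => by
    rw [← ofReal_norm, ← ofReal_norm, Complex.norm_real]
  simp_rw [hu, SchwartzMap.lintegral_enorm_abs_rpow_sq hq, finrank_euclideanSpace_fin,
    ← mul_assoc (d : ℝ≥0∞), ← one_add_mul] at hup
  rw [hpq] at hlow hup
  rw [eLpNorm_eq_lintegral_rpow_enorm_toReal (by simpa using hp0) ENNReal.ofReal_ne_top,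
    ENNReal.toReal_ofReal hp0.le]
  have hscale : (2 : ℝ) ^ (2 * α * (j : ℝ) / p) = (l ^ (2 * α)) ^ (1 / p) := by
    have hlj : l = (2 : ℝ) ^ (j : ℝ) := (Real.rpow_intCast 2 j).symm
    rw [hlj, ← Real.rpow_mul zero_le_two, ← Real.rpow_mul zero_le_two]
    congr 1
    ring
  have hroot : ∀ {a : ℝ}, 0 ≤ a → ENNReal.ofReal (a ^ (1 / p) * (2 : ℝ) ^ (2 * α * (j : ℝ) / p)) *
      (∫⁻ x, ‖f x‖ₑ ^ p) ^ (1 / p) =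
      (ENNReal.ofReal a * (ENNReal.ofReal (l ^ (2 * α)) * ∫⁻ x, ‖f x‖ₑ ^ p)) ^ (1 / p) :=
    fun {a} ha => by
      have hp' : 0 ≤ 1 / p := by positivity
      rw [hscale, ← Real.mul_rpow ha (by positivity), ← ENNReal.ofReal_rpow_of_nonneg
        (by positivity) hp', ← ENNReal.mul_rpow_of_nonneg _ _ hp', ENNReal.ofReal_mul ha, mul_assoc]
  rw [hroot (by positivity), hroot hD1.le]
  constructor
  · refine ENNReal.rpow_le_rpow ?_ (by positivity)
    refine (mul_le_mul_right hlow _).trans ?_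
    rw [← mul_assoc]
    refine mul_le_of_le_one_left' ?_
    calc ENNReal.ofReal ((K.toReal + 1) ^ 2)⁻¹ * K ^ 2
        ≤ ENNReal.ofReal ((K.toReal + 1) ^ 2)⁻¹ * ENNReal.ofReal (K.toReal + 1) ^ 2 := by
          gcongr
          rw [ENNReal.le_ofReal_iff_toReal_le hK (by positivity)]
          linarith
      _ = 1 := by
          rw [← ENNReal.ofReal_pow (by positivity), ← ENNReal.ofReal_mul (by positivity),
            inv_mul_cancel₀ (by positivity), ENNReal.ofReal_one]
  · refine ENNReal.rpow_le_rpow (hup.trans_eq ?_) (by positivity)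
    rw [ENNReal.ofReal_toReal hD, mul_left_comm]
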